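/- arXiv:2209.14087 — 6 statements merged into one kernel-verified Lean document; each statement's English description precedes it below -/
import Mathlib

section
/- Let G be a finite multigraph on n ≥ 1 vertices, let η, b > 0 and c ≥ 0 be reals, and write λ = 1 + η/b. Suppose an orientation of G satisfies d⁺(u) ≤ λ·d⁺(v) + c for every directed edge u→v. Then for every real γ > 0 there exists an integer k_max with 1 ≤ k_max ≤ log_{1+γ}(n) + 1 such that λ^{−k_max}·Δ ≤ (1+γ)·ρ(G) + c·(η^{−1}·b + 1), where Δ is the maximum out-degree of the orientation and ρ(G) is the maximum subgraph density of G. -/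
/-- The out-degree of a vertex `u` in a finite directed multigraph given by its
arc map `D : E → V × V` (each arc `e` goes from `(D e).1` to `(D e).2`). -/
def outDeg {V E : Type*} [Fintype E] [DecidableEq V] (D : E → V × V) (u : V) : ℕ :=
  (Finset.univ.filter fun e => (D e).1 = u).card

/-- The maximum out-degree of the orientation `D`. -/
def maxOutDeg {V E : Type*} [Fintype V] [Fintype E] [DecidableEq V] (D : E → V × V) : ℕ :=
  Finset.univ.sup (outDeg D)

/-- The maximum subgraph density of the underlying multigraph of `D`:
the maximum over (nonempty) vertex subsets `S` of `|E(S)| / |S|`, where `E(S)` is the set of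
edges with both endpoints in `S` (the empty set contributes `0/0 = 0`). -/
noncomputable def mdensity {V E : Type*} [Fintype V] [Fintype E] [DecidableEq V]
    (D : E → V × V) : NNReal :=
  Finset.univ.powerset.sup fun S : Finset V =>
    ((Finset.univ.filter fun e => (D e).1 ∈ S ∧ (D e).2 ∈ S).card : NNReal) / (S.card : NNReal)

/-- A sequence of positive naturals bounded by `n` grows by a factor of at most `1 + γ` at some
step `m ≤ log_{1+γ} n`. -/
lemma exists_step_le_mul (a : ℕ → ℕ) (n : ℕ) (γ : ℝ) (hγ : 0 < γ) (ha : 1 ≤ a 0)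
    (han : ∀ i, a i ≤ n) :
    ∃ m : ℕ, (m : ℝ) ≤ Real.logb (1 + γ) n ∧ (a (m + 1) : ℝ) ≤ (1 + γ) * a m := by
  classical
  have hγ1 : 1 < 1 + γ := by linarith
  have growth : ∀ m : ℕ, (∀ j < m, (1 + γ) * (a j : ℝ) < a (j + 1)) →
      (1 + γ) ^ m ≤ (a m : ℝ) := by
    intro m
    induction m with
    | zero => intro _; simpa using ha
    | succ m ih =>
      intro h
      have h₁ := ih fun j hj => h j (by omega)
      have h₂ := h m (by omega)
      rw [pow_succ']
      nlinarith
  have hex : ∃ m : ℕ, (a (m + 1) : ℝ) ≤ (1 + γ) * a m := by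
    by_contra! hno
    obtain ⟨m, hm⟩ := pow_unbounded_of_one_lt (n : ℝ) hγ1
    have h₁ := growth m fun j _ => hno j
    have h₂ : (a m : ℝ) ≤ n := by exact_mod_cast han m
    linarith
  refine ⟨Nat.find hex, ?_, Nat.find_spec hex⟩
  have h₁ := growth (Nat.find hex) fun j hj => not_le.mp (Nat.find_min hex hj)
  have h₂ : (a (Nat.find hex) : ℝ) ≤ n := by exact_mod_cast han _
  have hn : 0 < n := ha.trans (han 0)
  rw [Real.le_logb_iff_rpow_le hγ1 (by exact_mod_cast hn), Real.rpow_natCast]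
  exact h₁.trans h₂

/-- If `S ⊆ T` and all arcs leaving `S` end in `T`, the out-degrees over `S` sum to at most
`ρ |T|`. -/
lemma sum_outDeg_le_mdensity_mul_card {V E : Type*} [Fintype V] [Fintype E] [DecidableEq V]
    (D : E → V × V) {S T : Finset V} (hST : S ⊆ T) (hD : ∀ e, (D e).1 ∈ S → (D e).2 ∈ T) :
    (∑ v ∈ S, (outDeg D v : ℝ)) ≤ (mdensity D : ℝ) * T.card := by
  classical
  have hsum : ∑ v ∈ S, outDeg D v = (Finset.univ.filter fun e => (D e).1 ∈ S).card := by
    rw [Finset.card_eq_sum_card_fiberwise (f := fun e => (D e).1) (t := S)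
      (by intro e he; simpa using he)]
    refine Finset.sum_congr rfl fun v hv => ?_
    rw [outDeg, Finset.filter_filter]
    congr 1
    ext e
    simp only [Finset.mem_filter, Finset.mem_univ, true_and]
    exact ⟨fun h => ⟨h ▸ hv, h⟩, fun h => h.2⟩
  have hcard : (Finset.univ.filter fun e => (D e).1 ∈ S).card ≤
      (Finset.univ.filter fun e => (D e).1 ∈ T ∧ (D e).2 ∈ T).card :=
    Finset.card_le_card fun e he => by
      simp only [Finset.mem_filter, Finset.mem_univ, true_and] at he ⊢
      exact ⟨hST he, hD e he⟩
  rcases T.eq_empty_or_nonempty with rfl | hT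
  · simp [Finset.subset_empty.mp hST]
  have hdens : ((Finset.univ.filter fun e => (D e).1 ∈ T ∧ (D e).2 ∈ T).card : NNReal) /
      (T.card : NNReal) ≤ mdensity D :=
    Finset.le_sup (f := fun S : Finset V =>
      ((Finset.univ.filter fun e => (D e).1 ∈ S ∧ (D e).2 ∈ S).card : NNReal) /
        (S.card : NNReal)) (by simp)
  rw [div_le_iff₀ (by exact_mod_cast hT.card_pos)] at hdens
  have hdens' : ((Finset.univ.filter fun e => (D e).1 ∈ T ∧ (D e).2 ∈ T).card : ℝ) ≤
      (mdensity D : ℝ) * T.card := by exact_mod_cast hdens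
  refine le_trans ?_ hdens'
  exact_mod_cast hsum.trans_le hcard

/-- **Structural theorem.** If an orientation of a finite multigraph on `n ≥ 1` vertices
satisfies `d⁺(u) ≤ (1 + η/b)·d⁺(v) + c` for every directed edge `u → v`, then for every
`γ > 0` there is an integer `k_max` with `1 ≤ k_max ≤ log_{1+γ} n + 1` such that
`(1 + η/b)^{-k_max} · Δ ≤ (1+γ)·ρ + c·(η⁻¹·b + 1)`. -/
theorem structural_theorem
    {V E : Type*} [Fintype V] [Fintype E] [DecidableEq V]
    (D : E → V × V) (η b c : ℝ) (hη : 0 < η) (hb : 0 < b) (hc : 0 ≤ c)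
    (hn : 1 ≤ Fintype.card V)
    (hinv : ∀ e : E, (outDeg D (D e).1 : ℝ) ≤ (1 + η / b) * (outDeg D (D e).2 : ℝ) + c) :
    ∀ γ : ℝ, 0 < γ → ∃ k : ℕ, 1 ≤ k ∧
      (k : ℝ) ≤ Real.logb (1 + γ) (Fintype.card V) + 1 ∧
      (1 + η / b)⁻¹ ^ k * (maxOutDeg D : ℝ) ≤
        (1 + γ) * (mdensity D : ℝ) + c * (η⁻¹ * b + 1) := by
  intro γ hγ
  set l : ℝ := 1 + η / b with hl
  have hl1 : 1 < l := by have := div_pos hη hb; linarith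
  have hl0 : 0 < l := by linarith
  set K : ℝ := c * (η⁻¹ * b) with hK
  have hK0 : 0 ≤ K := by positivity
  have hKc : l * K = K + c := by rw [hl, hK]; field_simp
  set M : ℝ := (maxOutDeg D : ℝ) with hM
  have hM0 : 0 ≤ M := by positivity
  have hx1 : l⁻¹ ≤ 1 := inv_le_one_of_one_le₀ hl1.le
  have hx0 : 0 < l⁻¹ := by positivity
  have hanti (i : ℕ) : l⁻¹ ^ (i + 1) * (M + K) ≤ l⁻¹ ^ i * (M + K) :=
    mul_le_mul_of_nonneg_right (pow_le_pow_of_le_one hx0.le hx1 i.le_succ) (by positivity)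
  -- Shifting out-degrees by the fixed point `K` of `x ↦ (x + c) / l` makes the hypothesis purely
  -- multiplicative, so arcs leaving one level set end in the next.
  let T : ℕ → Finset V := fun i =>
    Finset.univ.filter fun v => l⁻¹ ^ i * (M + K) ≤ (outDeg D v : ℝ) + K
  have mem_T {i : ℕ} {v : V} : v ∈ T i ↔ l⁻¹ ^ i * (M + K) ≤ (outDeg D v : ℝ) + K := by
    simp [T]
  have hsub (i : ℕ) : T i ⊆ T (i + 1) := fun v hv =>
    mem_T.mpr ((hanti i).trans (mem_T.mp hv))
  have hT0 : (T 0).Nonempty := by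
    have : Nonempty V := Fintype.card_pos_iff.mp hn
    obtain ⟨v, -, hv⟩ := Finset.exists_mem_eq_sup (Finset.univ : Finset V)
      Finset.univ_nonempty (outDeg D)
    have hv' : maxOutDeg D = outDeg D v := hv
    exact ⟨v, mem_T.mpr (by simp [hM, hv'])⟩
  have hout (i : ℕ) (e : E) (he : (D e).1 ∈ T i) : (D e).2 ∈ T (i + 1) := by
    rw [mem_T] at he ⊢
    have h := hinv e
    rw [pow_succ', mul_assoc, inv_mul_le_iff₀ hl0]
    linarith
  obtain ⟨m, hm, hgrow⟩ := exists_step_le_mul (fun i => (T i).card) (Fintype.card V) γ hγ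
    hT0.card_pos fun i => Finset.card_le_univ _
  refine ⟨m + 1, by omega, by push_cast; linarith, ?_⟩
  have hpos : 0 < ((T m).card : ℝ) := by
    have h : (T 0) ⊆ T m := monotone_nat_of_le_succ hsub m.zero_le
    exact_mod_cast (hT0.mono h).card_pos
  have hsum := sum_outDeg_le_mdensity_mul_card D (hsub m) (hout m)
  have hlow : ((T m).card : ℝ) * (l⁻¹ ^ m * (M + K) - K) ≤ ∑ v ∈ T m, (outDeg D v : ℝ) := by
    rw [← nsmul_eq_mul]
    exact Finset.card_nsmul_le_sum _ _ _ fun v hv => by linarith [mem_T.mp hv]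
  have hρ : l⁻¹ ^ m * (M + K) - K ≤ (1 + γ) * (mdensity D : ℝ) := by
    refine le_of_mul_le_mul_left ?_ hpos
    have := mul_le_mul_of_nonneg_left hgrow (mdensity D).coe_nonneg
    linarith
  have hpow : 0 ≤ l⁻¹ ^ (m + 1) * K := by positivity
  have := hanti m
  rw [mul_add c, ← hK]
  linarith
end

section
/- Let G be a finite simple graph on n ≥ 2 vertices and let D be an orientation of G such that d⁺(u) ≤ (1 + 1/(2·ln n))·d⁺(v) + 2 for every directed edge u→v. Then the maximum out-degree of D satisfies Δ(D) ≤ e²·(2·ρ(G) + 4·ln n + 2), where ρ(G) is the maximum subgraph density of G; in particular Δ(D) = O(ρ(G) + log n). -/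
/-- An orientation of a finite simple graph `G`: each edge gets exactly one of its two
possible directions. -/
structure GraphOrientation {V : Type*} (G : SimpleGraph V) where
  dir : V → V → Bool
  dir_adj : ∀ u v, dir u v = true → G.Adj u v
  adj_iff : ∀ u v, G.Adj u v → (dir u v = true ↔ ¬ dir v u = true)

/-- The out-degree of a vertex `u` in an orientation of a finite simple graph. -/
def oOutDeg {V : Type*} [Fintype V] {G : SimpleGraph V} (O : GraphOrientation G) (u : V) : ℕ :=
  (Finset.univ.filter fun v => O.dir u v = true).card

/-- The maximum subgraph density of a finite simple graph: the maximum over (nonempty)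
vertex subsets `S` of `|E(S)| / |S|`, where `E(S)` is the set of edges of `G` with both
endpoints in `S`. -/
noncomputable def sdensity {V : Type*} [Fintype V] [DecidableEq V] (G : SimpleGraph V)
    [DecidableRel G.Adj] : NNReal :=
  Finset.univ.powerset.sup fun S : Finset V =>
    (((G.edgeFinset ∩ S.sym2).card : NNReal)) / (S.card : NNReal)

open Finset in
/-- If `S ⊆ T` and all out-neighbours of `S` lie in `T`, then the out-degrees over `S` sum to at
most the number of edges inside `T`. -/
lemma sum_oOutDeg_le_card_edges {V : Type*} [Fintype V] [DecidableEq V] {G : SimpleGraph V}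
    [DecidableRel G.Adj] (O : GraphOrientation G) {S T : Finset V} (hST : S ⊆ T)
    (hout : ∀ u ∈ S, ∀ v, O.dir u v = true → v ∈ T) :
    ∑ u ∈ S, oOutDeg O u ≤ #(G.edgeFinset ∩ T.sym2) := by
  unfold oOutDeg
  rw [← card_sigma]
  refine card_le_card_of_injOn (fun p => s(p.1, p.2)) ?_ ?_
  · rintro ⟨u, v⟩ h
    simp only [coe_sigma, Set.mem_sigma_iff, mem_coe, mem_filter, mem_univ, true_and] at h
    simp only [coe_inter, Set.mem_inter_iff, mem_coe, SimpleGraph.mem_edgeFinset,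
      SimpleGraph.mem_edgeSet, mk_mem_sym2_iff]
    exact ⟨O.dir_adj _ _ h.2, hST h.1, hout _ h.1 _ h.2⟩
  · rintro ⟨u, v⟩ h ⟨u', v'⟩ h' he
    simp only [coe_sigma, Set.mem_sigma_iff, mem_coe, mem_filter, mem_univ, true_and] at h h'
    rcases Sym2.eq_iff.1 he with ⟨rfl, rfl⟩ | ⟨rfl, rfl⟩
    · rfl
    · exact absurd h'.2 ((O.adj_iff _ _ (O.dir_adj _ _ h.2)).1 h.2)

open Finset in
lemma card_edges_le_sdensity_mul {V : Type*} [Fintype V] [DecidableEq V] (G : SimpleGraph V)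
    [DecidableRel G.Adj] (T : Finset V) :
    (#(G.edgeFinset ∩ T.sym2) : ℝ) ≤ sdensity G * #T := by
  rcases T.eq_empty_or_nonempty with rfl | hT
  · simp
  have h : (#(G.edgeFinset ∩ T.sym2) : NNReal) / #T ≤ sdensity G :=
    le_sup (f := fun S : Finset V => (#(G.edgeFinset ∩ S.sym2) : NNReal) / #S)
      (mem_powerset.2 (subset_univ T))
  have hpos : (0 : NNReal) < #T := by exact_mod_cast hT.card_pos
  exact_mod_cast (div_le_iff₀ hpos).1 h

open Finset in
/-- If all out-degrees over a nonempty `S ⊆ T` exceed twice the maximum subgraph density and all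
out-neighbours of `S` lie in `T`, then `T` is at least twice as large as `S`. -/
lemma two_mul_card_le_of_sdensity_lt {V : Type*} [Fintype V] [DecidableEq V] {G : SimpleGraph V}
    [DecidableRel G.Adj] (O : GraphOrientation G) {S T : Finset V} (hS : S.Nonempty)
    (hST : S ⊆ T) (hout : ∀ u ∈ S, ∀ v, O.dir u v = true → v ∈ T)
    (hdeg : ∀ u ∈ S, 2 * (sdensity G : ℝ) < oOutDeg O u) : 2 * #S ≤ #T := by
  have hsum : #S * (2 * (sdensity G : ℝ)) < ∑ u ∈ S, (oOutDeg O u : ℝ) := by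
    simpa using sum_lt_sum_of_nonempty hS hdeg
  have hedges : ∑ u ∈ S, (oOutDeg O u : ℝ) ≤ #(G.edgeFinset ∩ T.sym2) := by
    exact_mod_cast sum_oOutDeg_le_card_edges O hST hout
  have hlt : (sdensity G : ℝ) * (2 * #S) < sdensity G * #T := by
    linarith [card_edges_le_sdensity_mul G T]
  exact_mod_cast (lt_of_mul_lt_mul_left hlt (sdensity G).coe_nonneg).le

/-- Let `G` be a finite simple graph on `n ≥ 2` vertices and `D` an orientation of `G`
with `d⁺(u) ≤ (1 + 1/(2 ln n))·d⁺(v) + 2` for every directed edge `u → v`. Then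
`Δ(D) ≤ e²·(2·ρ(G) + 4·ln n + 2)`; in particular `Δ(D) = O(ρ(G) + log n)`. -/
theorem maxOutDeg_le_of_additive_invariant
    {V : Type*} [Fintype V] [DecidableEq V] (G : SimpleGraph V) [DecidableRel G.Adj]
    (hn : 2 ≤ Fintype.card V)
    (O : GraphOrientation G)
    (hinv : ∀ u v, O.dir u v = true →
      (oOutDeg O u : ℝ) ≤
        (1 + 1 / (2 * Real.log (Fintype.card V))) * (oOutDeg O v : ℝ) + 2) :
    ((Finset.univ.sup (oOutDeg O) : ℕ) : ℝ) ≤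
      Real.exp 2 * (2 * (sdensity G : ℝ) + 4 * Real.log (Fintype.card V) + 2) := by
  set L : ℝ := Real.log (Fintype.card V)
  have hLpos : 0 < L := Real.log_pos (by exact_mod_cast hn)
  set q : ℝ := 1 + 1 / (2 * L) with hq
  have hq_one : 1 ≤ q := by rw [hq]; linarith [show 0 < 1 / (2 * L) by positivity]
  have hstep : ∀ u v, O.dir u v = true →
      (oOutDeg O u : ℝ) + 4 * L ≤ q * (oOutDeg O v + 4 * L) := by
    intro u v huv
    have hfix : q * (4 * L) = 4 * L + 2 := by rw [hq]; field_simp; ring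
    linarith [hinv u v huv]
  by_contra! hlarge
  have hV : (Finset.univ : Finset V).Nonempty := by
    rw [← Finset.card_pos, Finset.card_univ]; omega
  obtain ⟨w, -, hw⟩ := Finset.exists_mem_eq_sup _ hV (oOutDeg O)
  rw [hw] at hlarge
  set k := Nat.log 2 (Fintype.card V)
  have hpow : ∀ i ≤ k, q ^ i ≤ Real.exp 2 := by
    intro i hi
    have hkL : (i : ℝ) ≤ 4 * L := by
      have hle : ((2 ^ k : ℕ) : ℝ) ≤ Fintype.card V := by
        exact_mod_cast Nat.pow_log_le_self 2 (by omega)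
      have hlog := Real.log_le_log (by positivity) hle
      rw [Nat.cast_pow, Real.log_pow, Nat.cast_ofNat] at hlog
      have hik : (i : ℝ) ≤ k := by exact_mod_cast hi
      nlinarith [Real.log_two_gt_d9]
    calc q ^ i ≤ Real.exp (1 / (2 * L)) ^ i := by
          gcongr
          rw [hq, add_comm]
          exact Real.add_one_le_exp _
      _ = Real.exp (i * (1 / (2 * L))) := (Real.exp_nat_mul _ _).symm
      _ ≤ Real.exp 2 := by
          gcongr
          rw [mul_one_div, div_le_iff₀ (by positivity)]
          linarith
  let S : ℕ → Finset V := fun i =>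
    Finset.univ.filter fun v => (oOutDeg O w : ℝ) + 4 * L ≤ q ^ i * (oOutDeg O v + 4 * L)
  have hmem : ∀ i v, v ∈ S i ↔
      (oOutDeg O w : ℝ) + 4 * L ≤ q ^ i * (oOutDeg O v + 4 * L) := by simp [S]
  have hgrow : ∀ i ≤ k + 1, 2 ^ i ≤ (S i).card := by
    intro i
    induction i with
    | zero =>
      intro _
      exact Finset.card_pos.2 ⟨w, (hmem _ _).2 (by simp)⟩
    | succ i ih =>
      intro hi
      have hcard := ih (by omega)
      have hdouble : 2 * (S i).card ≤ (S (i + 1)).card := by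
        refine two_mul_card_le_of_sdensity_lt O
          (Finset.card_pos.1 (lt_of_lt_of_le (by positivity) hcard)) ?_ ?_ ?_
        · intro v hv
          rw [hmem] at hv ⊢
          refine hv.trans ?_
          gcongr
          omega
        · intro u hu v huv
          rw [hmem] at hu ⊢
          rw [pow_succ, mul_assoc]
          exact hu.trans (by gcongr; exact hstep u v huv)
        · intro u hu
          have hle : (oOutDeg O w : ℝ) + 4 * L ≤ Real.exp 2 * (oOutDeg O u + 4 * L) :=
            ((hmem _ _).1 hu).trans (by gcongr; exact hpow i (by omega))
          have hlt : Real.exp 2 * (2 * (sdensity G : ℝ) + 4 * L + 2) <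
              Real.exp 2 * (oOutDeg O u + 4 * L) := by linarith
          linarith [lt_of_mul_lt_mul_left hlt (Real.exp_pos 2).le]
      rw [pow_succ]
      omega
  have hupper : Fintype.card V < 2 ^ (k + 1) := Nat.lt_pow_succ_log_self (by norm_num) _
  have hsub := (S (k + 1)).card_le_univ
  have := hgrow (k + 1) le_rfl
  omega
end

section
/- Let G be a finite simple graph on n ≥ 2 vertices, let 0 < ε ≤ 1, let b be a positive integer, and let D be an orientation of the multigraph G^b (G with every edge replaced by b parallel copies) such that d⁺(u) ≤ (1+x)·d⁺(v) for every directed edge u→v, where 0 < x ≤ (ε/20)·ln(1+ε/10)/ln n. Then b·ρ(G) ≤ Δ(D) ≤ (1+ε)·b·ρ(G); in other words, b^{−1}·Δ(D) is a (1+ε)-approximation of the maximum subgraph density ρ(G). -/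
/-- In an orientation of `G^b`, the arcs inside `S` number `b` times the edges inside `S`. -/
theorem sum_arcs_inside_eq {V : Type*} [Fintype V] [DecidableEq V] (G : SimpleGraph V)
    [DecidableRel G.Adj] (b : ℕ) (w : V → V → ℕ)
    (hsum : ∀ u v, G.Adj u v → w u v + w v u = b)
    (hzero : ∀ u v, ¬ G.Adj u v → w u v = 0) (S : Finset V) :
    ∑ u ∈ S, ∑ v ∈ S, w u v = (G.edgeFinset ∩ S.sym2).card * b := by
  have hfilter : ∑ p ∈ (S ×ˢ S).filter (fun p => G.Adj p.1 p.2), w p.1 p.2 =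
      ∑ p ∈ S ×ˢ S, w p.1 p.2 := by
    refine Finset.sum_filter_of_ne fun p _ hp => ?_
    by_contra h
    exact hp (hzero _ _ h)
  rw [← Finset.sum_product', ← hfilter,
    ← Finset.sum_fiberwise_of_maps_to (t := G.edgeFinset ∩ S.sym2)
      (g := fun p : V × V => s(p.1, p.2))]
  · refine Finset.sum_const_nat fun e he => ?_
    induction e using Sym2.ind with
    | _ u v =>
      simp only [Finset.mem_inter, SimpleGraph.mem_edgeFinset, SimpleGraph.mem_edgeSet,
        Finset.mk_mem_sym2_iff] at he
      obtain ⟨huv, hu, hv⟩ := he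
      have hfiber : ((S ×ˢ S).filter (fun p => G.Adj p.1 p.2)).filter
          (fun p => s(p.1, p.2) = s(u, v)) = {(u, v), (v, u)} := by
        ext ⟨p, q⟩
        simp only [Finset.mem_filter, Finset.mem_product, Sym2.eq_iff, Finset.mem_insert,
          Finset.mem_singleton, Prod.mk.injEq]
        constructor
        · exact fun h => h.2
        · rintro (⟨rfl, rfl⟩ | ⟨rfl, rfl⟩)
          · exact ⟨⟨⟨hu, hv⟩, huv⟩, Or.inl ⟨rfl, rfl⟩⟩
          · exact ⟨⟨⟨hv, hu⟩, huv.symm⟩, Or.inr ⟨rfl, rfl⟩⟩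
      rw [hfiber, Finset.sum_pair]
      · exact hsum u v huv
      · intro h
        exact huv.ne (Prod.mk.inj h).1
  · rintro ⟨p, q⟩ h
    simp only [Finset.mem_filter, Finset.mem_product] at h
    simp [h.1.1, h.1.2, h.2]

/-- Every vertex subset spans at most `ρ(G) * |S|` edges. -/
theorem card_edges_inside_le {V : Type*} [Fintype V] [DecidableEq V] (G : SimpleGraph V)
    [DecidableRel G.Adj] (S : Finset V) :
    ((G.edgeFinset ∩ S.sym2).card : ℝ) ≤ (sdensity G : ℝ) * S.card := by
  rcases S.eq_empty_or_nonempty with rfl | hS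
  · simp
  · have h : ((G.edgeFinset ∩ S.sym2).card : NNReal) / (S.card : NNReal) ≤ sdensity G :=
      Finset.le_sup (f := fun S : Finset V =>
        (((G.edgeFinset ∩ S.sym2).card : NNReal)) / (S.card : NNReal))
        (Finset.mem_powerset.2 (Finset.subset_univ S))
    have hpos : (0 : NNReal) < S.card := by exact_mod_cast hS.card_pos
    rw [div_le_iff₀ hpos] at h
    exact_mod_cast h

/-- The arcs leaving `S` all end in `T ⊇ S`, so they are counted by the edges inside `T`. -/
theorem sum_outDeg_le_density {V : Type*} [Fintype V] [DecidableEq V] (G : SimpleGraph V)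
    [DecidableRel G.Adj] (b : ℕ) (w : V → V → ℕ)
    (hsum : ∀ u v, G.Adj u v → w u v + w v u = b)
    (hzero : ∀ u v, ¬ G.Adj u v → w u v = 0) {S T : Finset V} (hST : S ⊆ T)
    (hout : ∀ u ∈ S, ∀ v, 1 ≤ w u v → v ∈ T) :
    ∑ u ∈ S, ((∑ z, w u z : ℕ) : ℝ) ≤ b * (sdensity G : ℝ) * T.card := by
  have hnat : ∑ u ∈ S, ∑ z, w u z ≤ (G.edgeFinset ∩ T.sym2).card * b := by
    rw [← sum_arcs_inside_eq G b w hsum hzero T]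
    calc ∑ u ∈ S, ∑ z, w u z = ∑ u ∈ S, ∑ z ∈ T, w u z := by
          refine Finset.sum_congr rfl fun u hu => ?_
          refine (Finset.sum_subset (Finset.subset_univ T) fun v _ hv => ?_).symm
          by_contra h
          exact hv (hout u hu v (Nat.one_le_iff_ne_zero.2 h))
      _ ≤ ∑ u ∈ T, ∑ z ∈ T, w u z := Finset.sum_le_sum_of_subset hST
  have hreal : ∑ u ∈ S, ((∑ z, w u z : ℕ) : ℝ) ≤ (G.edgeFinset ∩ T.sym2).card * (b : ℝ) := by
    exact_mod_cast hnat
  calc _ ≤ (G.edgeFinset ∩ T.sym2).card * (b : ℝ) := hreal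
    _ ≤ ((sdensity G : ℝ) * T.card) * b := by
        gcongr
        exact card_edges_inside_le G T
    _ = _ := by ring

/-- The density of `G` is attained by some vertex subset. -/
theorem exists_sdensity_eq {V : Type*} [Fintype V] [DecidableEq V] (G : SimpleGraph V)
    [DecidableRel G.Adj] :
    ∃ S : Finset V, (sdensity G : ℝ) = ((G.edgeFinset ∩ S.sym2).card : ℝ) / S.card := by
  obtain ⟨S, -, hS⟩ := Finset.exists_mem_eq_sup (Finset.univ : Finset V).powerset
    ⟨∅, Finset.empty_mem_powerset _⟩ (fun S : Finset V =>
      (((G.edgeFinset ∩ S.sym2).card : NNReal)) / (S.card : NNReal))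
  refine ⟨S, ?_⟩
  rw [sdensity, hS]
  push_cast
  rfl

/-- The density, scaled by `b`, is at most any bound on the out-degrees. -/
theorem mul_sdensity_le_of_outDeg_le {V : Type*} [Fintype V] [DecidableEq V]
    (G : SimpleGraph V) [DecidableRel G.Adj] (b : ℕ) (w : V → V → ℕ)
    (hsum : ∀ u v, G.Adj u v → w u v + w v u = b)
    (hzero : ∀ u v, ¬ G.Adj u v → w u v = 0) (Δ : ℕ) (hΔ : ∀ u, ∑ z, w u z ≤ Δ) :
    (b : ℝ) * (sdensity G : ℝ) ≤ Δ := by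
  obtain ⟨S, hS⟩ := exists_sdensity_eq G
  have hnat : (G.edgeFinset ∩ S.sym2).card * b ≤ S.card * Δ := by
    rw [← sum_arcs_inside_eq G b w hsum hzero S]
    refine Finset.sum_le_card_nsmul _ _ _ fun u _ => ?_
    exact (Finset.sum_le_sum_of_subset (Finset.subset_univ S)).trans (hΔ u)
  have hreal : ((G.edgeFinset ∩ S.sym2).card : ℝ) * b ≤ S.card * Δ := by exact_mod_cast hnat
  rw [hS, mul_div_assoc']
  refine div_le_of_le_mul₀ (by positivity) (by positivity) ?_
  linarith

/-- A sequence growing by a factor `exp r` in each of the first `m + 1` steps, starting at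
`1` or more, exceeds `exp ((m + 1) * r)`. -/
theorem exp_lt_of_geometric_growth (N : ℕ → ℝ) (r : ℝ) (m : ℕ) (h0 : 1 ≤ N 0)
    (hstep : ∀ i ≤ m, Real.exp r * N i < N (i + 1)) :
    Real.exp ((m + 1) * r) < N (m + 1) := by
  have hmul : ∀ j : ℕ, Real.exp (((j : ℝ) + 1) * r) = Real.exp r * Real.exp (j * r) := by
    intro j
    rw [← Real.exp_add]
    ring_nf
  induction m with
  | zero =>
    refine lt_of_le_of_lt ?_ (hstep 0 le_rfl)
    rw [hmul]
    simpa using le_mul_of_one_le_right (Real.exp_pos r).le h0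
  | succ m ih =>
    refine lt_trans ?_ (hstep (m + 1) le_rfl)
    rw [hmul]
    push_cast
    exact mul_lt_mul_of_pos_left (ih fun i hi => hstep i (by omega)) (Real.exp_pos r)

/-- The bound on `x` keeps `(1 + x) ^ i` below `√(1 + ε)` for all `i ≤ 2 ln n / ln (1 + ε)`. -/
theorem one_add_pow_le_exp_half_log {ε x L : ℝ} (hε : 0 < ε) (hε1 : ε ≤ 1) (hL : 0 < L)
    (hx : 0 < x) (hxle : x ≤ (ε / 20) * Real.log (1 + ε / 10) / L) {i : ℕ}
    (hi : (i : ℝ) ≤ 2 * L / Real.log (1 + ε)) :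
    (1 + x) ^ i ≤ Real.exp (Real.log (1 + ε) / 2) := by
  have hlog : ε / 2 ≤ Real.log (1 + ε) := by
    have h := Real.one_sub_inv_le_log_of_pos (show (0 : ℝ) < 1 + ε by linarith)
    have h' : 1 - (1 + ε)⁻¹ = ε / (1 + ε) := by field_simp; ring
    rw [h'] at h
    refine le_trans ?_ h
    gcongr
    linarith
  have hlog10 : Real.log (1 + ε / 10) ≤ ε / 10 := by
    have h := Real.log_le_sub_one_of_pos (show (0 : ℝ) < 1 + ε / 10 by linarith)
    linarith
  set l := Real.log (1 + ε)
  have hl : 0 < l := by linarith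
  have hxL : x * L ≤ ε / 20 * (ε / 10) := by
    rw [le_div_iff₀ hL] at hxle
    exact hxle.trans (by gcongr)
  have hil : (i : ℝ) * l ≤ 2 * L := by rwa [le_div_iff₀ hl] at hi
  have hix : (i : ℝ) * x ≤ l / 2 := by
    refine le_of_mul_le_mul_right ?_ hl
    nlinarith [mul_le_mul_of_nonneg_right hil hx.le, mul_le_mul hlog hlog (by positivity) hl.le]
  calc (1 + x) ^ i ≤ (Real.exp x) ^ i := by
        gcongr
        linarith [Real.add_one_le_exp x]
    _ = Real.exp (i * x) := (Real.exp_nat_mul x i).symm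
    _ ≤ _ := Real.exp_le_exp.2 hix

/-- Let `G` be a finite simple graph on `n ≥ 2` vertices, `0 < ε ≤ 1`, `b` a positive
integer, and let `D` be an orientation of the multigraph `G^b` (each edge of `G` replaced
by `b` parallel copies), encoded by `w : V → V → ℕ` where `w u v` counts the copies of
`{u,v}` directed from `u` to `v`; its out-degree is `d⁺(u) = ∑_z w u z` and its maximum
out-degree is `Δ(D) = max_u d⁺(u)`. If `d⁺(u) ≤ (1+x)·d⁺(v)` for every directed edge
`u → v` (i.e. whenever `w u v ≥ 1`), where `0 < x ≤ (ε/20)·ln(1+ε/10)/ln n`, then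
`b·ρ(G) ≤ Δ(D) ≤ (1+ε)·b·ρ(G)`, i.e. `b⁻¹·Δ(D)` is a `(1+ε)`-approximation of the
maximum subgraph density `ρ(G)`. -/
theorem maxOutDeg_approximates_density
    {V : Type*} [Fintype V] [DecidableEq V] (G : SimpleGraph V) [DecidableRel G.Adj]
    (hn : 2 ≤ Fintype.card V)
    (ε : ℝ) (hε : 0 < ε) (hε1 : ε ≤ 1)
    (b : ℕ) (hb : 0 < b)
    (w : V → V → ℕ)
    (hsum : ∀ u v, G.Adj u v → w u v + w v u = b)
    (hzero : ∀ u v, ¬ G.Adj u v → w u v = 0)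
    (x : ℝ) (hx : 0 < x)
    (hxle : x ≤ (ε / 20) * Real.log (1 + ε / 10) / Real.log (Fintype.card V))
    (hinv : ∀ u v, 1 ≤ w u v →
      ((∑ z, w u z : ℕ) : ℝ) ≤ (1 + x) * ((∑ z, w v z : ℕ) : ℝ)) :
    (b : ℝ) * (sdensity G : ℝ) ≤ ((Finset.univ.sup fun u => ∑ z, w u z : ℕ) : ℝ) ∧
    ((Finset.univ.sup fun u => ∑ z, w u z : ℕ) : ℝ) ≤ (1 + ε) * (b : ℝ) * (sdensity G : ℝ) := by
  set Δ : ℕ := Finset.univ.sup fun u => ∑ z, w u z with hΔdef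
  have hΔ : ∀ u, ∑ z, w u z ≤ Δ := fun u =>
    Finset.le_sup (f := fun u => ∑ z, w u z) (Finset.mem_univ u)
  refine ⟨mul_sdensity_le_of_outDeg_le G b w hsum hzero Δ hΔ, ?_⟩
  by_contra! hcon
  have hρ : 0 ≤ (b : ℝ) * (sdensity G : ℝ) := by positivity
  have hΔpos : (0 : ℝ) < Δ := lt_of_le_of_lt (by positivity) hcon
  have hn' : (2 : ℝ) ≤ Fintype.card V := by exact_mod_cast hn
  have hL : 0 < Real.log (Fintype.card V) := Real.log_pos (by linarith)
  have hl : 0 < Real.log (1 + ε) := Real.log_pos (by linarith)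
  have hsqrt : Real.exp (Real.log (1 + ε) / 2) * Real.exp (Real.log (1 + ε) / 2) = 1 + ε := by
    rw [← Real.exp_add, add_halves, Real.exp_log (by linarith)]
  set a := 2 * Real.log (Fintype.card V) / Real.log (1 + ε) with ha
  set s := Real.exp (Real.log (1 + ε) / 2)
  have hs : 0 < s := Real.exp_pos _
  -- The level sets of out-degree at least `Δ / (1 + x) ^ i`.
  let T : ℕ → Finset V := fun i =>
    Finset.univ.filter fun v => (Δ : ℝ) ≤ (1 + x) ^ i * ((∑ z, w v z : ℕ) : ℝ)
  have hT : ∀ i v, v ∈ T i ↔ (Δ : ℝ) ≤ (1 + x) ^ i * ((∑ z, w v z : ℕ) : ℝ) := by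
    simp [T]
  have hmono : ∀ i, T i ⊆ T (i + 1) := by
    intro i v hv
    rw [hT] at hv ⊢
    refine hv.trans ?_
    gcongr
    · linarith
    · omega
  have hT0 : (1 : ℝ) ≤ (T 0).card := by
    have : Nonempty V := Fintype.card_pos_iff.1 (by omega)
    obtain ⟨u, -, hu⟩ := Finset.exists_mem_eq_sup (Finset.univ : Finset V)
      Finset.univ_nonempty (fun u => ∑ z, w u z)
    have hmem : u ∈ T 0 := by
      rw [hT, pow_zero, one_mul, ← hu]
    exact_mod_cast Finset.card_pos.2 ⟨u, hmem⟩
  have hTpos : ∀ i, (0 : ℝ) < (T i).card := by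
    intro i
    have hsub : (T 0).card ≤ (T i).card :=
      Finset.card_le_card (monotone_nat_of_le_succ hmono (Nat.zero_le i))
    have : ((T 0).card : ℝ) ≤ (T i).card := by exact_mod_cast hsub
    linarith
  have hstep : ∀ i ≤ ⌊a⌋₊, s * ((T i).card : ℝ) < (T (i + 1)).card := by
    intro i hi
    have hia : (i : ℝ) ≤ a :=
      (Nat.cast_le.2 hi).trans (Nat.floor_le (by positivity))
    have hpow : (1 + x) ^ i ≤ s := one_add_pow_le_exp_half_log hε hε1 hL hx hxle hia
    have hcount := sum_outDeg_le_density G b w hsum hzero (hmono i) (fun u hu v huv => by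
      rw [hT] at hu ⊢
      calc (Δ : ℝ) ≤ (1 + x) ^ i * ((∑ z, w u z : ℕ) : ℝ) := hu
        _ ≤ (1 + x) ^ i * ((1 + x) * ((∑ z, w v z : ℕ) : ℝ)) := by
            gcongr
            exact hinv u v huv
        _ = _ := by ring)
    have hlower : ((T i).card : ℝ) * Δ ≤ s * ∑ u ∈ T i, ((∑ z, w u z : ℕ) : ℝ) := by
      rw [Finset.mul_sum, ← nsmul_eq_mul]
      refine Finset.card_nsmul_le_sum _ _ _ fun u hu => ?_
      exact ((hT i u).1 hu).trans (by gcongr)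
    have hub : ((T i).card : ℝ) * Δ ≤ s * (b * (sdensity G : ℝ) * (T (i + 1)).card) :=
      hlower.trans (mul_le_mul_of_nonneg_left hcount hs.le)
    have hcon' : s * s * (b * (sdensity G : ℝ)) < Δ := by
      rw [hsqrt]
      linarith
    by_contra! hle
    have hchain : ((T i).card : ℝ) * Δ ≤ (T i).card * (s * s * (b * (sdensity G : ℝ))) :=
      calc ((T i).card : ℝ) * Δ ≤ s * (b * (sdensity G : ℝ) * (T (i + 1)).card) := hub
        _ ≤ s * (b * (sdensity G : ℝ) * (s * (T i).card)) := by gcongr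
        _ = _ := by ring
    exact absurd (le_of_mul_le_mul_left hchain (hTpos i)) (not_le.2 hcon')
  have hgrow := exp_lt_of_geometric_growth (fun i => ((T i).card : ℝ)) _ ⌊a⌋₊ hT0 hstep
  have hcard : ((T (⌊a⌋₊ + 1)).card : ℝ) ≤ Fintype.card V := by
    exact_mod_cast Finset.card_le_univ _
  have hexp : (Fintype.card V : ℝ) ≤ Real.exp ((⌊a⌋₊ + 1) * (Real.log (1 + ε) / 2)) := by
    rw [← Real.log_le_iff_le_exp (by linarith)]
    have hfloor := (Nat.lt_floor_add_one a).le
    rw [ha, div_le_iff₀ hl] at hfloor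
    linarith
  linarith
end

section
/- Let G be a finite simple graph that admits an orientation in which every vertex has out-degree at most d, for some positive integer d. Then the edge set of G can be partitioned into 2d sets, each of which forms an acyclic subgraph of G (i.e., G decomposes into 2d forests). -/
/-- A graph is acyclic if, for some ranking of its vertices, every vertex has at most one
neighbour of rank at least its own. -/
theorem SimpleGraph.isAcyclic_of_rank {V α : Type*} [LinearOrder α] {H : SimpleGraph V}
    (r : V → α)
    (h : ∀ u v w, H.Adj u v → H.Adj u w → r u ≤ r v → r u ≤ r w → v = w) :
    H.IsAcyclic := by
  classical
  intro a p hp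
  obtain ⟨m, hm, hmin⟩ := p.support.toFinset.exists_min_image r ⟨a, by simp⟩
  rw [List.mem_toFinset] at hm
  have hc := hp.rotate hm
  have hle : ∀ x ∈ (p.rotate m hm).support, r m ≤ r x := fun x hx =>
    hmin x (List.mem_toFinset.2 ((p.mem_support_rotate_iff m hm).1 hx))
  exact hc.snd_ne_penultimate (h m _ _ ((p.rotate m hm).adj_snd hc.not_nil)
    ((p.rotate m hm).adj_penultimate hc.not_nil).symm
    (hle _ (SimpleGraph.Walk.getVert_mem_support _ _))
    (hle _ (SimpleGraph.Walk.getVert_mem_support _ _)))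

/-- Out-edges at each vertex can be labelled injectively with `d` labels when all
out-degrees are at most `d`. -/
theorem GraphOrientation.exists_outLabelling {V : Type*} [Fintype V] {G : SimpleGraph V}
    (O : GraphOrientation G) {d : ℕ} (hd : 0 < d) (hO : ∀ u, oOutDeg O u ≤ d) :
    ∃ c : V → V → Fin d, ∀ u v w, O.dir u v = true → O.dir u w = true →
      c u v = c u w → v = w := by
  have key (u : V) : ∃ f : V → Fin d, ∀ v w, O.dir u v = true → O.dir u w = true →
      f v = f w → v = w := by
    obtain ⟨e⟩ : Nonempty ({v // O.dir u v = true} ↪ Fin d) :=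
      Function.Embedding.nonempty_of_card_le (by
        simpa [Fintype.card_subtype, oOutDeg] using hO u)
    refine ⟨fun v => if hv : O.dir u v = true then e ⟨v, hv⟩ else ⟨0, hd⟩, ?_⟩
    intro v w hv hw hvw
    simpa [hv, hw] using hvw
  choose c hc using key
  exact ⟨c, hc⟩

/-- If a finite simple graph `G` admits an orientation in which every vertex has
out-degree at most `d` (for a positive integer `d`), then its edge set can be partitioned
into `2d` sets, each of which forms an acyclic subgraph of `G`; i.e. `G` decomposes into
`2d` forests. -/
theorem forest_decomposition
    {V : Type*} [Fintype V] [DecidableEq V] (G : SimpleGraph V) [DecidableRel G.Adj]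
    (d : ℕ) (hd : 0 < d)
    (hor : ∃ O : GraphOrientation G, ∀ u, oOutDeg O u ≤ d) :
    ∃ Es : Fin (2 * d) → Set (Sym2 V),
      (⋃ i, Es i) = G.edgeSet ∧
      (Pairwise fun i j => Disjoint (Es i) (Es j)) ∧
      (∀ i, (SimpleGraph.fromEdgeSet (Es i)).IsAcyclic) := by
  obtain ⟨O, hO⟩ := hor
  obtain ⟨c, hc⟩ := O.exists_outLabelling hd hO
  let r : V ≃ Fin (Fintype.card V) := Fintype.equivFin V
  let E : Fin 2 × Fin d ≃ Fin (2 * d) := finProdFinEquiv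
  let col : V → V → Fin 2 × Fin d := fun u v => (if r u < r v then 0 else 1, c u v)
  let Es : Fin (2 * d) → Set (Sym2 V) := fun i =>
    {e | ∃ u v, e = s(u, v) ∧ O.dir u v = true ∧ E (col u v) = i}
  refine ⟨Es, ?_, ?_, ?_⟩
  · ext e
    induction e with | _ x y
    simp only [Es, Set.mem_iUnion, Set.mem_ofPred_eq, SimpleGraph.mem_edgeSet]
    constructor
    · rintro ⟨i, u, v, he, huv, -⟩
      exact (SimpleGraph.mem_edgeSet G).1 (he ▸ (SimpleGraph.mem_edgeSet G).2 (O.dir_adj u v huv))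
    · intro hxy
      by_cases hd' : O.dir x y = true
      · exact ⟨_, x, y, rfl, hd', rfl⟩
      · exact ⟨_, y, x, Sym2.eq_swap, (O.adj_iff y x hxy.symm).2 hd', rfl⟩
  · intro i j hij
    rw [Set.disjoint_left]
    rintro e ⟨u, v, rfl, huv, hi⟩ ⟨u', v', he, huv', hj⟩
    rcases Sym2.eq_iff.1 he with ⟨rfl, rfl⟩ | ⟨rfl, rfl⟩
    · exact hij (hi.symm.trans hj)
    · exact (O.adj_iff u v (O.dir_adj u v huv)).1 huv huv'
  · intro i
    obtain ⟨⟨b, k⟩, rfl⟩ := E.surjective i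
    have hadj {u v : V} (h : (SimpleGraph.fromEdgeSet (Es (E (b, k)))).Adj u v) :
        u ≠ v ∧ (O.dir u v = true ∧ col u v = (b, k) ∨ O.dir v u = true ∧ col v u = (b, k)) := by
      obtain ⟨⟨x, y, he, hxy, hk⟩, hne⟩ := (SimpleGraph.fromEdgeSet_adj _).1 h
      have hk := E.injective hk
      rcases Sym2.eq_iff.1 he with ⟨rfl, rfl⟩ | ⟨rfl, rfl⟩
      · exact ⟨hne, .inl ⟨hxy, hk⟩⟩
      · exact ⟨hne, .inr ⟨hxy, hk⟩⟩
    obtain rfl | rfl : b = 0 ∨ b = 1 := by omega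
    · have hout {u v : V} (h : (SimpleGraph.fromEdgeSet (Es (E (0, k)))).Adj u v)
          (hle : r u ≤ r v) : O.dir u v = true ∧ c u v = k := by
        obtain ⟨hne, ⟨hdir, hcol⟩ | ⟨hdir, hcol⟩⟩ := hadj h
        · exact ⟨hdir, congrArg Prod.snd hcol⟩
        · simp [col, hle.not_gt] at hcol
      refine SimpleGraph.isAcyclic_of_rank r fun u v w huv huw hv hw => ?_
      obtain ⟨hdv, hcv⟩ := hout huv hv
      obtain ⟨hdw, hcw⟩ := hout huw hw
      exact hc u v w hdv hdw (hcv.trans hcw.symm)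
    · have hout {u v : V} (h : (SimpleGraph.fromEdgeSet (Es (E (1, k)))).Adj u v)
          (hle : r v ≤ r u) : O.dir u v = true ∧ c u v = k := by
        obtain ⟨hne, ⟨hdir, hcol⟩ | ⟨hdir, hcol⟩⟩ := hadj h
        · exact ⟨hdir, congrArg Prod.snd hcol⟩
        · have hlt : r v < r u := lt_of_le_of_ne hle (r.injective.ne hne.symm)
          simp [col, hlt] at hcol
      refine SimpleGraph.isAcyclic_of_rank (fun x => OrderDual.toDual (r x))
        fun u v w huv huw hv hw => ?_
      obtain ⟨hdv, hcv⟩ := hout huv hv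
      obtain ⟨hdw, hcw⟩ := hout huw hw
      exact hc u v w hdv hdw (hcv.trans hcw.symm)
end

section
/- For every finite simple graph G and every real λ ≥ 1, there exists an orientation of G such that for every directed edge u→v one has d⁺(u) ≤ λ·d⁺(v) + 2. -/
namespace GraphOrientation

variable {V : Type*} {G : SimpleGraph V}

/-- Every graph has an orientation: direct each edge upwards along a linear order. -/
theorem nonempty (G : SimpleGraph V) : Nonempty (GraphOrientation G) := by
  classical
  let _ : LinearOrder V := WellOrderingRel.isWellOrder.linearOrder
  refine ⟨⟨fun u v => decide (G.Adj u v ∧ u < v), fun u v h => (of_decide_eq_true h).1, ?_⟩⟩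
  intro u v h
  simp only [decide_eq_true_eq, h, h.symm, true_and, not_lt]
  exact ⟨le_of_lt, fun hle => lt_of_le_of_ne hle h.ne⟩

/-- Reverse the directed edge `u → v`. -/
def reverseEdge [DecidableEq V] (O : GraphOrientation G) {u v : V} (h : O.dir u v = true) :
    GraphOrientation G where
  dir a b := if a = u ∧ b = v then false else if a = v ∧ b = u then true else O.dir a b
  dir_adj a b := by
    have huv := O.dir_adj u v h
    split_ifs with h₁ h₂
    · simp
    · rintro -
      rw [h₂.1, h₂.2]
      exact huv.symm
    · exact O.dir_adj a b
  adj_iff a b hab := by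
    have huv := (O.dir_adj u v h).ne
    have := O.adj_iff a b hab
    grind

variable [Fintype V] [DecidableEq V]

theorem oOutDeg_reverseEdge_tail (O : GraphOrientation G) {u v : V} (h : O.dir u v = true) :
    oOutDeg (O.reverseEdge h) u + 1 = oOutDeg O u := by
  have huv := (O.dir_adj u v h).ne
  unfold oOutDeg
  rw [← Finset.card_erase_add_one (s := Finset.univ.filter fun w => O.dir u w = true) (a := v)
    (by simpa using h)]
  congr 2
  ext w
  simp only [reverseEdge, Finset.mem_filter, Finset.mem_univ, true_and, Finset.mem_erase]
  grind

theorem oOutDeg_reverseEdge_head (O : GraphOrientation G) {u v : V} (h : O.dir u v = true) :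
    oOutDeg (O.reverseEdge h) v = oOutDeg O v + 1 := by
  have huv := O.dir_adj u v h
  have hne := huv.ne
  have hvu := (O.adj_iff u v huv).1 h
  unfold oOutDeg
  rw [← Finset.card_insert_of_notMem (s := Finset.univ.filter fun w => O.dir v w = true) (a := u)
    (by simpa using hvu)]
  congr 1
  ext w
  simp only [reverseEdge, Finset.mem_filter, Finset.mem_univ, true_and, Finset.mem_insert]
  grind

theorem oOutDeg_reverseEdge_of_ne (O : GraphOrientation G) {u v w : V} (h : O.dir u v = true)
    (hu : w ≠ u) (hv : w ≠ v) : oOutDeg (O.reverseEdge h) w = oOutDeg O w := by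
  simp [oOutDeg, reverseEdge, hu, hv]

/-- Reversing an edge whose tail has out-degree exceeding that of its head by at least two
decreases the sum of the squared out-degrees. -/
theorem sum_sq_oOutDeg_reverseEdge_lt (O : GraphOrientation G) {u v : V} (h : O.dir u v = true)
    (hlt : oOutDeg O v + 1 < oOutDeg O u) :
    ∑ w, oOutDeg (O.reverseEdge h) w ^ 2 < ∑ w, oOutDeg O w ^ 2 := by
  have hne := (O.dir_adj u v h).ne
  have hv : v ∈ Finset.univ.erase u := by simp [hne.symm]
  have hrest : ∑ w ∈ (Finset.univ.erase u).erase v, oOutDeg (O.reverseEdge h) w ^ 2 =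
      ∑ w ∈ (Finset.univ.erase u).erase v, oOutDeg O w ^ 2 := by
    refine Finset.sum_congr rfl fun w hw => ?_
    simp only [Finset.mem_erase, Finset.mem_univ, and_true] at hw
    rw [O.oOutDeg_reverseEdge_of_ne h hw.2 hw.1]
  simp only [← Finset.add_sum_erase _ _ (Finset.mem_univ u), ← Finset.add_sum_erase _ _ hv, hrest]
  have htail := O.oOutDeg_reverseEdge_tail h
  rw [O.oOutDeg_reverseEdge_head h]
  rw [← htail] at hlt ⊢
  nlinarith

/-- Some orientation has out-degrees dropping by at most one along every directed edge. -/
theorem exists_oOutDeg_le_add_one (G : SimpleGraph V) :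
    ∃ O : GraphOrientation G, ∀ u v, O.dir u v = true → oOutDeg O u ≤ oOutDeg O v + 1 := by
  have := nonempty G
  let O := Function.argmin fun O : GraphOrientation G => ∑ w, oOutDeg O w ^ 2
  refine ⟨O, fun u v h => ?_⟩
  by_contra! hlt
  exact Function.not_lt_argmin (fun O : GraphOrientation G => ∑ w, oOutDeg O w ^ 2) _
    (O.sum_sq_oOutDeg_reverseEdge_lt h hlt)

end GraphOrientation

/-- For every finite simple graph `G` and every real `λ ≥ 1`, there exists an orientation
of `G` such that `d⁺(u) ≤ λ·d⁺(v) + 2` for every directed edge `u → v`. -/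
theorem exists_orientation_additive_invariant
    {V : Type*} [Fintype V] [DecidableEq V] (G : SimpleGraph V) [DecidableRel G.Adj]
    (lam : ℝ) (hlam : 1 ≤ lam) :
    ∃ O : GraphOrientation G, ∀ u v, O.dir u v = true →
      (oOutDeg O u : ℝ) ≤ lam * (oOutDeg O v : ℝ) + 2 := by
  obtain ⟨O, hO⟩ := GraphOrientation.exists_oOutDeg_le_add_one G
  refine ⟨O, fun u v h => ?_⟩
  have hle : (oOutDeg O u : ℝ) ≤ oOutDeg O v + 1 := by exact_mod_cast hO u v h
  have hmul := le_mul_of_one_le_left (Nat.cast_nonneg (α := ℝ) (oOutDeg O v)) hlam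
  linarith
end

section
/- Let D be an orientation of a finite multigraph G on n vertices with maximum subgraph density ρ(G) > 0, let u be a vertex, let λ > 1 be a real, and let k be a positive integer. For j ≥ 0 let B_j denote the set of vertices reachable from u by a directed path of length at most j in D. If every vertex of B_{k−1} has out-degree at least λ·ρ(G), then |B_j| ≥ λ^j for every 0 ≤ j ≤ k; in particular k ≤ log_λ n. Consequently, there always exists a vertex at directed distance at most log_λ n from u whose out-degree is less than λ·ρ(G). -/
/-- `ball step u j` is the set of vertices reachable from `u` by a directed path of length
at most `j` along the relation `step`. -/
def ball {V : Type*} (step : V → V → Prop) (u : V) : ℕ → Set V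
  | 0 => {u}
  | j + 1 => ball step u j ∪ {v | ∃ a ∈ ball step u j, step a v}

theorem ball_mono {V : Type*} (step : V → V → Prop) (u : V) : Monotone (ball step u) :=
  monotone_nat_of_le_succ fun _ => Set.subset_union_left

/-- The number of arcs inside `S` is at most `mdensity D` times the size of `S`. -/
theorem card_arcs_le_mdensity_mul {V E : Type*} [Fintype V] [Fintype E] [DecidableEq V]
    (D : E → V × V) (S : Finset V) :
    ((Finset.univ.filter fun e => (D e).1 ∈ S ∧ (D e).2 ∈ S).card : ℝ) ≤
      (mdensity D : ℝ) * S.card := by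
  rcases S.eq_empty_or_nonempty with rfl | hS
  · simp
  · have h : ((Finset.univ.filter fun e => (D e).1 ∈ S ∧ (D e).2 ∈ S).card : NNReal) /
        (S.card : NNReal) ≤ mdensity D :=
      Finset.le_sup (f := fun S : Finset V =>
        ((Finset.univ.filter fun e => (D e).1 ∈ S ∧ (D e).2 ∈ S).card : NNReal) /
          (S.card : NNReal)) (by simp)
    rw [div_le_iff₀ (by exact_mod_cast hS.card_pos)] at h
    exact_mod_cast h

theorem sum_outDeg_eq_card {V E : Type*} [Fintype E] [DecidableEq V]
    (D : E → V × V) (S : Finset V) :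
    ∑ v ∈ S, outDeg D v = (Finset.univ.filter fun e => (D e).1 ∈ S).card := by
  rw [Finset.card_eq_sum_card_fiberwise (f := fun e => (D e).1) (t := S)
    (fun e he => by simpa using he)]
  refine Finset.sum_congr rfl fun v hv => ?_
  rw [outDeg, Finset.filter_filter]
  congr 1
  ext e
  simp only [Finset.mem_filter, Finset.mem_univ, true_and]
  exact ⟨fun h => ⟨h ▸ hv, h⟩, fun h => h.2⟩

/-- If all out-degrees in a set `S` are at least `lam * mdensity D`, then any superset `T` of `S`
containing the heads of all arcs leaving `S` is larger than `S` by a factor of at least `lam`. -/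
theorem mul_card_le_card_of_le_outDeg {V E : Type*} [Fintype V] [Fintype E] [DecidableEq V]
    (D : E → V × V) (hρ : 0 < (mdensity D : ℝ)) {lam : ℝ} {S T : Finset V} (hST : S ⊆ T)
    (hT : ∀ e, (D e).1 ∈ S → (D e).2 ∈ T)
    (hS : ∀ v ∈ S, lam * (mdensity D : ℝ) ≤ (outDeg D v : ℝ)) :
    lam * S.card ≤ T.card := by
  refine le_of_mul_le_mul_left ?_ hρ
  calc (mdensity D : ℝ) * (lam * S.card) = ∑ _v ∈ S, lam * (mdensity D : ℝ) := by
        rw [Finset.sum_const, nsmul_eq_mul]; ring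
    _ ≤ ∑ v ∈ S, (outDeg D v : ℝ) := Finset.sum_le_sum hS
    _ = ((Finset.univ.filter fun e => (D e).1 ∈ S).card : ℝ) := by
        rw [← sum_outDeg_eq_card, Nat.cast_sum]
    _ ≤ ((Finset.univ.filter fun e => (D e).1 ∈ T ∧ (D e).2 ∈ T).card : ℝ) := by
        refine Nat.cast_le.2 (Finset.card_le_card fun e he => ?_)
        simp only [Finset.mem_filter, Finset.mem_univ, true_and] at he ⊢
        exact ⟨hST he, hT e he⟩
    _ ≤ (mdensity D : ℝ) * T.card := card_arcs_le_mdensity_mul D T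

theorem pow_le_ncard_ball {V E : Type*} [Fintype V] [Fintype E] [DecidableEq V]
    (D : E → V × V) (hρ : 0 < (mdensity D : ℝ)) (u : V) {lam : ℝ} (hlam : 0 ≤ lam)
    {step : V → V → Prop} (hstep : ∀ a b, step a b ↔ ∃ e, D e = (a, b)) (j : ℕ)
    (hbig : ∀ i < j, ∀ v ∈ ball step u i, lam * (mdensity D : ℝ) ≤ (outDeg D v : ℝ)) :
    lam ^ j ≤ ((ball step u j).ncard : ℝ) := by
  classical
  induction j with
  | zero => simp [ball]
  | succ j ih =>
    have key : lam * ((ball step u j).toFinset.card : ℝ) ≤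
        ((ball step u (j + 1)).toFinset.card : ℝ) := by
      refine mul_card_le_card_of_le_outDeg D hρ
        (Set.toFinset_subset_toFinset.2 (ball_mono step u j.le_succ)) (fun e he => ?_)
        (fun v hv => hbig j j.lt_succ_self v (Set.mem_toFinset.1 hv))
      rw [Set.mem_toFinset] at he ⊢
      exact Or.inr ⟨_, he, (hstep _ _).2 ⟨e, rfl⟩⟩
    rw [← Set.ncard_eq_toFinset_card', ← Set.ncard_eq_toFinset_card'] at key
    calc lam ^ (j + 1) = lam * lam ^ j := pow_succ' lam j
      _ ≤ lam * ((ball step u j).ncard : ℝ) :=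
        mul_le_mul_of_nonneg_left (ih fun i hi => hbig i (hi.trans j.lt_succ_self)) hlam
      _ ≤ _ := key

theorem le_logb_card_of_pow_le_ncard {V : Type*} [Fintype V] {lam : ℝ} (hlam : 1 < lam)
    {s : Set V} {j : ℕ} (h : lam ^ j ≤ (s.ncard : ℝ)) :
    (j : ℝ) ≤ Real.logb lam (Fintype.card V) := by
  have hcard : lam ^ j ≤ (Fintype.card V : ℝ) :=
    h.trans (by exact_mod_cast Nat.card_eq_fintype_card (α := V) ▸ Set.ncard_le_card s)
  rw [Real.le_logb_iff_rpow_le hlam ((pow_pos (zero_lt_one.trans hlam) j).trans_le hcard),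
    Real.rpow_natCast]
  exact hcard

/-- Let `D` be an orientation of a finite multigraph on `n` vertices with maximum subgraph
density `ρ > 0`, let `u` be a vertex, `λ > 1` a real and `k` a positive integer, and let
`B_j` be the set of vertices reachable from `u` by a directed path of length at most `j`.
If every vertex of `B_{k-1}` has out-degree at least `λ·ρ`, then `|B_j| ≥ λ^j` for all
`0 ≤ j ≤ k`; in particular `k ≤ log_λ n`. Consequently, there always exists a vertex at
directed distance at most `log_λ n` from `u` whose out-degree is less than `λ·ρ`. -/
theorem exists_nearby_low_outDeg
    {V E : Type*} [Fintype V] [Fintype E] [DecidableEq V]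
    (D : E → V × V) (hρ : 0 < (mdensity D : ℝ))
    (u : V) (lam : ℝ) (hlam : 1 < lam) (k : ℕ) (hk : 1 ≤ k)
    (step : V → V → Prop) (hstep : ∀ a b, step a b ↔ ∃ e, D e = (a, b))
    (hbig : ∀ v ∈ ball step u (k - 1), lam * (mdensity D : ℝ) ≤ (outDeg D v : ℝ)) :
    (∀ j ≤ k, lam ^ j ≤ ((ball step u j).ncard : ℝ)) ∧
    ((k : ℝ) ≤ Real.logb lam (Fintype.card V)) ∧
    (∃ v ∈ ball step u ⌊Real.logb lam (Fintype.card V)⌋₊,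
      (outDeg D v : ℝ) < lam * (mdensity D : ℝ)) := by
  have hlam0 : 0 ≤ lam := zero_le_one.trans hlam.le
  have hpow : ∀ j ≤ k, lam ^ j ≤ ((ball step u j).ncard : ℝ) := fun j hj =>
    pow_le_ncard_ball D hρ u hlam0 hstep j fun i hi v hv =>
      hbig v (ball_mono step u (by omega) hv)
  refine ⟨hpow, le_logb_card_of_pow_le_ncard hlam (hpow k le_rfl), ?_⟩
  by_contra! hall
  have hlog := le_logb_card_of_pow_le_ncard hlam
    (pow_le_ncard_ball D hρ u hlam0 hstep (⌊Real.logb lam (Fintype.card V)⌋₊ + 1)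
      fun i hi v hv => hall v (ball_mono step u (Nat.lt_succ_iff.1 hi) hv))
  have hfloor := Nat.lt_floor_add_one (Real.logb lam (Fintype.card V))
  push_cast at hlog
  linarith
end
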